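/- For every l ≥ 0, the ℤ-linear map ℤ^{m(l)} → ℤ^{m(l+1)} given by the matrix M_{l,l+1}^t − I_{l,l+1}^t is injective; consequently the inductive limit of the kernels (which computes K_1 of the matrix system (M,I), hence K_1 of the C*-algebra O_{𝔏^{Ch(D_F)}}) is the trivial group. -/

import Mathlib

noncomputable section



open Finset

/-- Admissibility for the golden-mean (Fibonacci) shift: words over the alphabet
`{1,2}` (coded as `Fin 2`, where `0` codes the letter `1` and `1` codes the letter `2`)
with no two consecutive letters equal to `2`. -/
def DyckAdm (l : ℕ) (w : Fin l → Fin 2) : Prop :=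
  ∀ i j : Fin l, (j : ℕ) = (i : ℕ) + 1 → ¬(w i = 1 ∧ w j = 1)

instance (l : ℕ) : DecidablePred (DyckAdm l) := fun w => by
  unfold DyckAdm; infer_instance

/-- The set `W_l` of admissible words of length `l`. -/
def Wset (l : ℕ) : Finset (Fin l → Fin 2) := univ.filter (DyckAdm l)

/-- `m(l)`, the number of admissible words of length `l`. -/
def mW (l : ℕ) : ℕ := (Wset l).card

/-- Lexicographic (from the left) strict order on words. -/
def lexLt (l : ℕ) (u w : Fin l → Fin 2) : Prop :=
  ∃ i : Fin l, (∀ j : Fin l, j < i → u j = w j) ∧ u i < w i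

instance (l : ℕ) : DecidableRel (lexLt l) := fun u w => by
  unfold lexLt; infer_instance

/-- The (1-based) position of an admissible word in the lexicographic ordering of `W_l`,
identifying `W_l` with `{1, …, m(l)}`. -/
def rankW (l : ℕ) (w : Fin l → Fin 2) : ℕ :=
  1 + ((Wset l).filter (fun u => lexLt l u w)).card

/-- The matrix `I_{l,l+1}` (1-based indices, entries outside `{1,…,m(l)} × {1,…,m(l+1)}`
are `0`): `I_{l,l+1}(w,w') = 1` iff the word `w'` with its last letter deleted is `w`. -/
def Imat (l : ℕ) : ℕ → ℕ → ℤ := fun i j =>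
  if ∃ w ∈ Wset l, ∃ w' ∈ Wset (l + 1),
      rankW l w = i ∧ rankW (l + 1) w' = j ∧ (∀ k : Fin l, w k = w' k.castSucc)
  then 1 else 0

/-- The matrix `M_{l,l+1}` (1-based indices):
`M_{l,l+1}(w,w') = |{k ∈ {1,2} : w' = k·w}| + ε(w,w')`, where `ε(w,w') = 1` iff
`F(w_1,w'_1) = 1` and `(w_2,…,w_l) = (w'_1,…,w'_{l-1})`; `M_{0,1} = [3 2]`.
(Here `F(a,b) = 0` iff both letters are `2`, i.e. both codes are `1`.) -/
def Mmat : ℕ → ℕ → ℕ → ℤ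
  | 0, i, j => if i = 1 ∧ j = 1 then 3 else if i = 1 ∧ j = 2 then 2 else 0
  | (l + 1), i, j =>
      ∑ w ∈ Wset (l + 1), ∑ w' ∈ Wset (l + 2),
        if rankW (l + 1) w = i ∧ rankW (l + 2) w' = j then
          ((if (∀ t : Fin (l + 1), w' t.succ = w t) then (1 : ℤ) else 0) +
           (if (¬(w 0 = 1 ∧ w' 0 = 1)) ∧
               (∀ t : Fin (l + 1), (t : ℕ) ≠ 0 →
                 w t = w' ⟨(t : ℕ) - 1,
                   (Nat.sub_le _ _).trans_lt (t.isLt.trans (Nat.lt_succ_self _))⟩)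
            then (1 : ℤ) else 0))
        else 0

/-- The matrices `S_l` (of size `m(l-1) × m(l+1)`, 1-based indices):
`S_0 = [1 1]`, `S_1 = [1 1 1]`, `S_{l+2} = [[S_{l+1}, 0], [0, S_l]]` (block diagonal). -/
def Smat : ℕ → ℕ → ℕ → ℤ
  | 0, i, j => if i = 1 ∧ (1 ≤ j ∧ j ≤ 2) then 1 else 0
  | 1, i, j => if i = 1 ∧ (1 ≤ j ∧ j ≤ 3) then 1 else 0
  | (l + 2), i, j =>
      if i ≤ mW l then (if j ≤ mW (l + 2) then Smat (l + 1) i j else 0)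
      else (if j ≤ mW (l + 2) then 0 else Smat l (i - mW l) (j - mW (l + 2)))

/-- The matrix `𝔸_{l+1,l} = M_{l,l+1}^t − I_{l,l+1}^t` (1-based indices). -/
def AmatN (l : ℕ) : ℕ → ℕ → ℤ := fun i j => Mmat l j i - Imat l j i

/-- `𝔸_{l+1,l} = M_{l,l+1}^t − I_{l,l+1}^t` as an `m(l+1) × m(l)` matrix over `Fin` types. -/
def AMat (l : ℕ) : Matrix (Fin (mW (l + 1))) (Fin (mW l)) ℤ :=
  fun i j => AmatN l ((i : ℕ) + 1) ((j : ℕ) + 1)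

theorem mem_Wset {l : ℕ} {w : Fin l → Fin 2} : w ∈ Wset l ↔ DyckAdm l w := by
  simp [Wset]

theorem lexLt_iff {l : ℕ} {u w : Fin l → Fin 2} : lexLt l u w ↔ toLex u < toLex w :=
  Iff.rfl

theorem rankW_lt_rankW {l : ℕ} {u w : Fin l → Fin 2} (hu : u ∈ Wset l) (h : lexLt l u w) :
    rankW l u < rankW l w := by
  refine Nat.add_lt_add_left (card_lt_card ⟨fun v hv => ?_, fun hs => ?_⟩) 1
  · rw [mem_filter] at hv ⊢
    exact ⟨hv.1, lexLt_iff.2 ((lexLt_iff.1 hv.2).trans (lexLt_iff.1 h))⟩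
  · have := hs (mem_filter.2 ⟨hu, h⟩)
    exact lt_irrefl _ (lexLt_iff.1 (mem_filter.1 this).2)

theorem rankW_injOn (l : ℕ) : Set.InjOn (rankW l) (Wset l) := by
  intro u hu w hw h
  rcases lt_trichotomy (toLex u) (toLex w) with h' | h' | h'
  · exact absurd h (rankW_lt_rankW hu h').ne
  · exact toLex.injective h'
  · exact absurd h (rankW_lt_rankW hw h').ne'

theorem rankW_le {l : ℕ} {w : Fin l → Fin 2} (hw : w ∈ Wset l) : rankW l w ≤ mW l := by
  have : ((Wset l).filter (fun u => lexLt l u w)).card < (Wset l).card :=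
    card_lt_card ⟨filter_subset _ _, fun hs =>
      lt_irrefl _ (lexLt_iff.1 (mem_filter.1 (hs hw)).2)⟩
  unfold rankW mW
  omega

theorem one_le_rankW (l : ℕ) (w : Fin l → Fin 2) : 1 ≤ rankW l w := Nat.le_add_right _ _

/-- The zero-based position of an admissible word. -/
def indexW (l : ℕ) (w : Wset l) : Fin (mW l) :=
  ⟨rankW l w - 1, by
    have := rankW_le w.2
    have := one_le_rankW l w
    omega⟩

theorem indexW_add_one {l : ℕ} (w : Wset l) : (indexW l w : ℕ) + 1 = rankW l w :=
  Nat.sub_add_cancel (one_le_rankW l w)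

theorem indexW_bijective (l : ℕ) : Function.Bijective (indexW l) := by
  rw [Fintype.bijective_iff_injective_and_card]
  refine ⟨fun u w h => Subtype.ext (rankW_injOn l u.2 w.2 ?_),
    by rw [Fintype.card_coe, Fintype.card_fin, mW]⟩
  rw [← indexW_add_one, ← indexW_add_one, h]

theorem Imat_rankW {l : ℕ} {w : Fin l → Fin 2} {w' : Fin (l + 1) → Fin 2} (hw : w ∈ Wset l)
    (hw' : w' ∈ Wset (l + 1)) :
    Imat l (rankW l w) (rankW (l + 1) w') = if w = Fin.init w' then 1 else 0 := by
  unfold Imat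
  congr 1
  refine propext ⟨?_, fun h => ⟨w, hw, w', hw', rfl, rfl, congrFun h⟩⟩
  rintro ⟨v, hv, v', hv', h, h', hvv⟩
  rw [← rankW_injOn l hv hw h, ← rankW_injOn (l + 1) hv' hw' h']
  exact funext hvv

theorem Mmat_rankW {l : ℕ} {w : Fin (l + 1) → Fin 2} {w' : Fin (l + 2) → Fin 2}
    (hw : w ∈ Wset (l + 1)) (hw' : w' ∈ Wset (l + 2)) :
    Mmat (l + 1) (rankW (l + 1) w) (rankW (l + 2) w') =
      (if w = Fin.tail w' then 1 else 0) +
        if ¬(w 0 = 1 ∧ w' 0 = 1) ∧ Fin.tail w = Fin.init (Fin.init w') then 1 else 0 := by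
  rw [Mmat, sum_eq_single_of_mem w hw, sum_eq_single_of_mem w' hw', if_pos ⟨rfl, rfl⟩]
  · congr 2
    · exact propext ⟨fun h => funext fun t => (h t).symm, fun h t => (congrFun h t).symm⟩
    · refine propext (and_congr_right fun _ => ⟨fun h => funext fun t => ?_, fun h t ht => ?_⟩)
      · exact h t.succ (by simp)
      · obtain ⟨s, rfl⟩ := Fin.exists_succ_eq.2 (fun h0 : t = 0 => ht (by simp [h0]))
        exact congrFun h s
  · intro v hv hne
    exact if_neg fun h => hne (rankW_injOn _ hv hw' h.2)
  · intro v hv hne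
    exact sum_eq_zero fun v' _ => if_neg fun h => hne (rankW_injOn _ hv hw h.1)

theorem DyckAdm.init {l : ℕ} {w : Fin (l + 1) → Fin 2} (h : DyckAdm (l + 1) w) :
    DyckAdm l (Fin.init w) :=
  fun i j hij => h i.castSucc j.castSucc (by simpa using hij)

theorem DyckAdm.tail {l : ℕ} {w : Fin (l + 1) → Fin 2} (h : DyckAdm (l + 1) w) :
    DyckAdm l (Fin.tail w) :=
  fun i j hij => h i.succ j.succ (by simpa using hij)

theorem DyckAdm.cons {l : ℕ} {w : Fin l → Fin 2} (h : DyckAdm l w) {a : Fin 2}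
    (ha : ∀ i : Fin l, (i : ℕ) = 0 → ¬(a = 1 ∧ w i = 1)) :
    DyckAdm (l + 1) (Fin.cons a w : Fin (l + 1) → Fin 2) := by
  intro i j hij
  induction j using Fin.cases with
  | zero => simp at hij
  | succ j =>
    induction i using Fin.cases with
    | zero => simpa using ha j (by simpa using hij)
    | succ i => simpa using h i j (by simpa using hij)

theorem DyckAdm.snoc_zero {l : ℕ} {w : Fin l → Fin 2} (h : DyckAdm l w) :
    DyckAdm (l + 1) (Fin.snoc w 0 : Fin (l + 1) → Fin 2) := by
  intro i j hij
  induction j using Fin.lastCases with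
  | last => simp
  | cast j =>
    induction i using Fin.lastCases with
    | last =>
      have := j.isLt
      simp at hij
      omega
    | cast i => simpa using h i j (by simpa using hij)

theorem init_cons_eq_cons_init {l : ℕ} {β : Type*} (a : β) (w : Fin (l + 1) → β) :
    (Fin.init (Fin.cons a w : Fin (l + 2) → β) : Fin (l + 1) → β) = Fin.cons a (Fin.init w) := by
  ext i
  cases i using Fin.cases <;> rfl

/-- The kernel equations of the matrices `M^t - I^t`, written for functions on words. -/
def KernelEq (l : ℕ) (f : (Fin (l + 1) → Fin 2) → ℤ) : Prop :=
  ∀ w ∈ Wset (l + 2),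
    f (Fin.tail w) + ∑ a : Fin 2,
      (if ¬(a = 1 ∧ w 0 = 1) then f (Fin.cons a (Fin.init (Fin.init w))) else 0) = f (Fin.init w)

/-- A solution of the kernel equations does not depend on the last letter. -/
theorem KernelEq.apply_eq_snoc {l : ℕ} {f : (Fin (l + 2) → Fin 2) → ℤ} (hf : KernelEq (l + 1) f)
    {w : Fin (l + 2) → Fin 2} (hw : DyckAdm (l + 2) w) :
    f w = f (Fin.snoc (Fin.init w) 0) := by
  have h₁ := hf (Fin.cons 0 w) (mem_Wset.2 (hw.cons (by simp)))
  have h₂ := hf (Fin.cons 0 (Fin.snoc (Fin.init w) 0 : Fin (l + 2) → Fin 2))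
    (mem_Wset.2 (hw.init.snoc_zero.cons (by simp)))
  have hi : (Fin.init (Fin.cons 0 (Fin.snoc (Fin.init w) 0 : Fin (l + 2) → Fin 2) :
      Fin (l + 3) → Fin 2) : Fin (l + 2) → Fin 2) =
      Fin.init (Fin.cons 0 w : Fin (l + 3) → Fin 2) := by
    rw [init_cons_eq_cons_init, init_cons_eq_cons_init, Fin.init_snoc]
  rw [hi] at h₂
  simp only [Fin.tail_cons, Fin.cons_zero] at h₁ h₂
  linarith

theorem KernelEq.snoc {l : ℕ} {f : (Fin (l + 2) → Fin 2) → ℤ} (hf : KernelEq (l + 1) f) :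
    KernelEq l fun v => f (Fin.snoc v 0) := by
  intro u hu
  rw [mem_Wset] at hu
  have h := hf (Fin.snoc u 0) (mem_Wset.2 hu.snoc_zero)
  have h0 : (Fin.snoc u 0 : Fin (l + 3) → Fin 2) 0 = u 0 :=
    Fin.snoc_castSucc (α := fun _ => Fin 2) 0 u 0
  have ht : (Fin.tail (Fin.snoc u 0 : Fin (l + 3) → Fin 2) : Fin (l + 2) → Fin 2) =
      Fin.snoc (Fin.tail u) 0 := by
    conv_lhs => rw [← Fin.cons_self_tail u]
    exact congrArg Fin.tail (Fin.cons_snoc_eq_snoc_cons (u 0) (Fin.tail u) (0 : Fin 2)).symm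
  rw [Fin.init_snoc, h0, ht, hf.apply_eq_snoc hu] at h
  refine Eq.trans ?_ h
  congr 1
  refine sum_congr rfl fun a _ => ?_
  split_ifs with ha
  · rfl
  · have hc : DyckAdm (l + 2) (Fin.cons a (Fin.init u) : Fin (l + 2) → Fin 2) := by
      refine hu.init.cons fun i hi => ?_
      obtain rfl : i = 0 := Fin.ext hi
      exact ha
    rw [hf.apply_eq_snoc hc, init_cons_eq_cons_init]

theorem KernelEq.eq_zero {l : ℕ} {f : (Fin (l + 1) → Fin 2) → ℤ} (hf : KernelEq l f)
    {w : Fin (l + 1) → Fin 2} (hw : DyckAdm (l + 1) w) : f w = 0 := by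
  induction l with
  | zero =>
    have h₁ := hf ![0, 0] (by decide)
    have h₂ := hf ![0, 1] (by decide)
    have hw : w = ![0] ∨ w = ![1] := by
      revert w
      decide
    have e : ∀ (a : Fin 2) (v : Fin 0 → Fin 2), (Fin.cons a v : Fin 1 → Fin 2) = ![a] := by
      decide
    have t₁ : (Fin.tail ![0, 0] : Fin 1 → Fin 2) = ![0] := by decide
    have t₂ : (Fin.tail ![0, 1] : Fin 1 → Fin 2) = ![1] := by decide
    have i₁ : (Fin.init ![0, 0] : Fin 1 → Fin 2) = ![0] := by decide
    have i₂ : (Fin.init ![0, 1] : Fin 1 → Fin 2) = ![0] := by decide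
    simp only [e, t₁, t₂, i₁, i₂, Fin.sum_univ_two] at h₁ h₂
    simp at h₁ h₂
    rcases hw with rfl | rfl <;> linarith
  | succ l ih => rw [hf.apply_eq_snoc hw, ih hf.snoc hw.init]

theorem AMat_mulVec_indexW {l : ℕ} (f : (Fin l → Fin 2) → ℤ) (x : Fin (mW l) → ℤ)
    (hfx : ∀ w, x (indexW l w) = f w) (w' : Wset (l + 1)) :
    (AMat l).mulVec x (indexW (l + 1) w') =
      ∑ w ∈ Wset l, (Mmat l (rankW l w) (rankW (l + 1) w') -
        Imat l (rankW l w) (rankW (l + 1) w')) * f w := by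
  rw [← sum_coe_sort]
  refine ((indexW_bijective l).sum_comp _).symm.trans (sum_congr rfl fun w _ => ?_)
  simp only [AMat, AmatN, indexW_add_one, hfx]

theorem kernelEq_of_mulVec_eq_zero {l : ℕ} (f : (Fin (l + 1) → Fin 2) → ℤ)
    (x : Fin (mW (l + 1)) → ℤ) (hfx : ∀ w, x (indexW (l + 1) w) = f w)
    (hx : (AMat (l + 1)).mulVec x = 0) : KernelEq l f := by
  intro w' hw'
  have h := congrFun hx (indexW (l + 2) ⟨w', hw'⟩)
  rw [AMat_mulVec_indexW f x hfx] at h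
  have hadm := mem_Wset.1 hw'
  have hε : ∑ w ∈ Wset (l + 1),
      (if ¬(w 0 = 1 ∧ w' 0 = 1) ∧ Fin.tail w = Fin.init (Fin.init w') then f w else 0) =
      ∑ a : Fin 2, if ¬(a = 1 ∧ w' 0 = 1) then f (Fin.cons a (Fin.init (Fin.init w'))) else 0 := by
    rw [← sum_filter, ← sum_filter]
    symm
    refine sum_nbij' (fun a => Fin.cons a (Fin.init (Fin.init w'))) (fun w => w 0) ?_ ?_ ?_ ?_ ?_
    · intro a ha
      rw [mem_filter] at ha
      refine mem_filter.2 ⟨mem_Wset.2 (hadm.init.init.cons fun i hi => ?_), by simpa using ha.2, ?_⟩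
      · have : (Fin.init (Fin.init w') : Fin l → Fin 2) i = w' 0 :=
          congrArg w' (Fin.ext hi)
        rw [this]
        exact ha.2
      · exact Fin.tail_cons _ _
    · intro w hw
      exact mem_filter.2 ⟨mem_univ _, (mem_filter.1 hw).2.1⟩
    · intro a _
      rfl
    · intro w hw
      rw [← (mem_filter.1 hw).2.2]
      exact Fin.cons_self_tail w
    · intro a _
      rfl
  rw [← hε]
  have hsum : ∀ w ∈ Wset (l + 1), (Mmat (l + 1) (rankW (l + 1) w) (rankW (l + 2) w') -
      Imat (l + 1) (rankW (l + 1) w) (rankW (l + 2) w')) * f w =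
      (if w = Fin.tail w' then f w else 0) +
      (if ¬(w 0 = 1 ∧ w' 0 = 1) ∧ Fin.tail w = Fin.init (Fin.init w') then f w else 0) -
      (if w = Fin.init w' then f w else 0) := by
    intro w hw
    rw [Mmat_rankW hw hw', Imat_rankW hw hw']
    simp only [sub_mul, add_mul, ite_mul, one_mul, zero_mul]
  rw [sum_congr rfl hsum, sum_sub_distrib, sum_add_distrib, sum_ite_eq', sum_ite_eq',
    if_pos (mem_Wset.2 hadm.tail), if_pos (mem_Wset.2 hadm.init)] at h
  exact sub_eq_zero.1 h

theorem eq_zero_of_AMat_mulVec_eq_zero {l : ℕ} {x : Fin (mW l) → ℤ}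
    (hx : (AMat l).mulVec x = 0) : x = 0 := by
  have hf : ∀ w, x (indexW l w) = if h : (w : Fin l → Fin 2) ∈ Wset l then x (indexW l ⟨w, h⟩)
      else 0 := fun w => by rw [dif_pos w.2]
  funext j
  obtain ⟨w, rfl⟩ := (indexW_bijective l).2 j
  cases l with
  | zero =>
    have hw' : (fun _ => 1 : Fin 1 → Fin 2) ∈ Wset 1 := by decide
    have h := congrFun hx (indexW 1 ⟨_, hw'⟩)
    rw [AMat_mulVec_indexW (fun v => if h : v ∈ Wset 0 then x (indexW 0 ⟨v, h⟩) else 0) x hf,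
      sum_eq_single_of_mem w.1 w.2 fun v _ hv => absurd (Subsingleton.elim _ _) hv,
      Imat_rankW w.2 hw', if_pos (Subsingleton.elim _ _), ← hf] at h
    have h₀ : rankW 0 w.1 = 1 := by
      have := rankW_le w.2
      have := one_le_rankW 0 w
      have : mW 0 = 1 := by decide
      omega
    have h₁ : rankW 1 (fun _ => 1 : Fin 1 → Fin 2) = 2 := by decide
    rw [h₀, h₁] at h
    simpa [Mmat] using h
  | succ l =>
    rw [hf]
    exact (kernelEq_of_mulVec_eq_zero
      (fun v => if h : v ∈ Wset (l + 1) then x (indexW (l + 1) ⟨v, h⟩) else 0) x hf hx).eq_zero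
      (mem_Wset.1 w.2)

/-- for every `l ≥ 0` the `ℤ`-linear map `ℤ^{m(l)} → ℤ^{m(l+1)}` given by
the matrix `M_{l,l+1}^t − I_{l,l+1}^t` is injective (its kernel is trivial); consequently
the inductive limit of the kernels, which computes `K_1(O_{𝔏^{Ch(D_F)}})`, is trivial. -/
theorem AMat_mulVecLin_injective :
    ∀ l : ℕ, Function.Injective (AMat l).mulVecLin ∧
      LinearMap.ker (AMat l).mulVecLin = ⊥ := by
  intro l
  have h : LinearMap.ker (AMat l).mulVecLin = ⊥ :=
    LinearMap.ker_eq_bot'.2 fun _ hx => eq_zero_of_AMat_mulVec_eq_zero hx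
  exact ⟨LinearMap.ker_eq_bot.1 h, h⟩
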